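/- arXiv:2008.12670 — 4 statements merged into one kernel-verified Lean document; each statement's English description precedes it below -/
import Mathlib

section
/- For all integers i, j with 1 ≤ i, j ≤ n−1, the following commutation relations hold as operators on M: δ_i ∘ s_j^R = s_j^R ∘ δ_i, ∂_i ∘ s_j^L = s_j^L ∘ ∂_i, and δ_i ∘ ∂_j = ∂_j ∘ δ_i. That is, the left divided difference operators commute with the right Weyl action and with the right divided difference (BGG) operators, and the right divided difference operators commute with the left Weyl action. -/
open MvPolynomial Finset

noncomputable section

/-- The field `F = ℚ(x_1, …, x_n)`, realized as the fraction field of `ℚ[x_1,…,x_n]`,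
with variables indexed by `Fin n` (so `x_a`, `1 ≤ a ≤ n`, corresponds to index `a-1`). -/
abbrev FF (n : ℕ) : Type := FractionRing (MvPolynomial (Fin n) ℚ)

/-- The action of `S_n` on `F` by `ℚ`-algebra automorphisms permuting the variables,
`w · x_i = x_{w(i)}`. -/
noncomputable def wAct {n : ℕ} (w : Equiv.Perm (Fin n)) : FF n ≃+* FF n :=
  IsFractionRing.ringEquivOfRingEquiv (MvPolynomial.renameEquiv ℚ w).toRingEquiv

/-- The variable `x` (with a `Fin n` index) as an element of `F`. -/
noncomputable def xv {n : ℕ} (i : Fin n) : FF n :=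
  algebraMap (MvPolynomial (Fin n) ℚ) (FF n) (MvPolynomial.X i)

/-- The localization model `M`: functions `S_n → F`, with pointwise operations. -/
abbrev MM (n : ℕ) : Type := Equiv.Perm (Fin n) → FF n

/-- The left Weyl action `(w^L f)(u) = w · (f (w⁻¹ u))`. -/
noncomputable def leftW {n : ℕ} (w : Equiv.Perm (Fin n)) (f : MM n) : MM n :=
  fun u => wAct w (f (w⁻¹ * u))

/-- The right Weyl action `(w^R f)(u) = f (u w)`. -/
noncomputable def rightW {n : ℕ} (w : Equiv.Perm (Fin n)) (f : MM n) : MM n :=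
  fun u => f (u * w)

/-- The simple transposition `s_i = (i, i+1)` (1-based index `i`, `1 ≤ i ≤ n-1`). -/
def sref {n : ℕ} (i : ℕ) (h1 : 1 ≤ i) (h2 : i ≤ n - 1) : Equiv.Perm (Fin n) :=
  Equiv.swap ⟨i - 1, by omega⟩ ⟨i, by omega⟩

/-- The simple root `α_i = x_i - x_{i+1}` (1-based index). -/
noncomputable def alf {n : ℕ} (i : ℕ) (h1 : 1 ≤ i) (h2 : i ≤ n - 1) : FF n :=
  xv ⟨i - 1, by omega⟩ - xv ⟨i, by omega⟩

/-- The fixed-point class `ε_w ∈ M`: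
`ε_w(u) = ∏_{a<b} (x_{w(b)} - x_{w(a)})` if `u = w`, and `0` otherwise. -/
noncomputable def eps {n : ℕ} (w : Equiv.Perm (Fin n)) : MM n := fun u =>
  if u = w then
    ∏ p ∈ Finset.univ.filter (fun p : Fin n × Fin n => p.1 < p.2), (xv (w p.2) - xv (w p.1))
  else 0

/-- The equivariant Euler class `e_w = ∏_{a<b} (x_{w(b)} - x_{w(a)})`. -/
noncomputable def euler {n : ℕ} (w : Equiv.Perm (Fin n)) : FF n :=
  ∏ p ∈ Finset.univ.filter (fun p : Fin n × Fin n => p.1 < p.2), (xv (w p.2) - xv (w p.1))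

/-- The Poincaré pairing `⟨f, g⟩ = Σ_w f(w) g(w) / e_w`. -/
noncomputable def pair {n : ℕ} (f g : MM n) : FF n :=
  ∑ w : Equiv.Perm (Fin n), f w * g w / euler w

/-- The right divided difference (BGG) operator `(∂_i f)(v) = (f(v) - f(v s_i)) / (-(v·α_i))`. -/
noncomputable def rdd {n : ℕ} (i : ℕ) (h1 : 1 ≤ i) (h2 : i ≤ n - 1) (f : MM n) : MM n :=
  fun v => (f v - f (v * sref i h1 h2)) / (-(wAct v (alf i h1 h2)))

/-- The left divided difference operator `(δ_i f)(v) = (f(v) - s_i·(f(s_i v))) / α_i`. -/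
noncomputable def ldd {n : ℕ} (i : ℕ) (h1 : 1 ≤ i) (h2 : i ≤ n - 1) (f : MM n) : MM n :=
  fun v => (f v - wAct (sref i h1 h2) (f (sref i h1 h2 * v))) / alf i h1 h2

/-- The left Demazure–Lusztig operator `T_i^L = -δ_i + s_i^L`. -/
noncomputable def tL {n : ℕ} (i : ℕ) (h1 : 1 ≤ i) (h2 : i ≤ n - 1) (f : MM n) : MM n :=
  -(ldd i h1 h2 f) + leftW (sref i h1 h2) f

/-- The dual left Demazure–Lusztig operator `T_i^{L,∨} = δ_i + s_i^L`. -/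
noncomputable def tLd {n : ℕ} (i : ℕ) (h1 : 1 ≤ i) (h2 : i ≤ n - 1) (f : MM n) : MM n :=
  ldd i h1 h2 f + leftW (sref i h1 h2) f

/-- The right Demazure–Lusztig operator `T_i^R = ∂_i - s_i^R`. -/
noncomputable def tR {n : ℕ} (i : ℕ) (h1 : 1 ≤ i) (h2 : i ≤ n - 1) (f : MM n) : MM n :=
  rdd i h1 h2 f - rightW (sref i h1 h2) f

/-- `wAct` is multiplicative in the permutation, so it is an action of `S_n` on `F`. -/
theorem wAct_mul_apply {n : ℕ} (u v : Equiv.Perm (Fin n)) (x : FF n) :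
    wAct (u * v) x = wAct u (wAct v x) := by
  obtain ⟨a, b, rfl⟩ := IsLocalization.exists_mk'_eq (nonZeroDivisors (MvPolynomial (Fin n) ℚ)) x
  simp only [IsFractionRing.mk'_eq_div, map_div₀, wAct,
    IsFractionRing.ringEquivOfRingEquiv_algebraMap]
  simp [MvPolynomial.rename_rename, Equiv.Perm.coe_mul]

theorem wAct_wAct_inv_mul {n : ℕ} (w v : Equiv.Perm (Fin n)) (x : FF n) :
    wAct w (wAct (w⁻¹ * v) x) = wAct v x := by
  rw [← wAct_mul_apply, mul_inv_cancel_left]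

theorem sref_inv {n : ℕ} (i : ℕ) (h1 : 1 ≤ i) (h2 : i ≤ n - 1) :
    (sref i h1 h2 : Equiv.Perm (Fin n))⁻¹ = sref i h1 h2 :=
  Equiv.swap_inv _ _

theorem wAct_sref_sref_mul {n : ℕ} (i : ℕ) (h1 : 1 ≤ i) (h2 : i ≤ n - 1)
    (v : Equiv.Perm (Fin n)) (x : FF n) :
    wAct (sref i h1 h2) (wAct (sref i h1 h2 * v) x) = wAct v x := by
  simpa only [sref_inv] using wAct_wAct_inv_mul (sref i h1 h2) v x

/-- Commutation relations: `δ_i ∘ s_j^R = s_j^R ∘ δ_i`, `∂_i ∘ s_j^L = s_j^L ∘ ∂_i`,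
and `δ_i ∘ ∂_j = ∂_j ∘ δ_i` as operators on `M`. -/
theorem divided_difference_commutation
    (n : ℕ) (hn : 2 ≤ n) (i j : ℕ) (hi1 : 1 ≤ i) (hi2 : i ≤ n - 1)
    (hj1 : 1 ≤ j) (hj2 : j ≤ n - 1) :
    (∀ f : MM n, ldd i hi1 hi2 (rightW (sref j hj1 hj2) f)
        = rightW (sref j hj1 hj2) (ldd i hi1 hi2 f)) ∧
    (∀ f : MM n, rdd i hi1 hi2 (leftW (sref j hj1 hj2) f)
        = leftW (sref j hj1 hj2) (rdd i hi1 hi2 f)) ∧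
    (∀ f : MM n, ldd i hi1 hi2 (rdd j hj1 hj2 f)
        = rdd j hj1 hj2 (ldd i hi1 hi2 f)) := by
  refine ⟨fun f => ?_, fun f => ?_, fun f => ?_⟩ <;> funext v
  · simp only [ldd, rightW, mul_assoc]
  · simp only [rdd, leftW, map_div₀, map_sub, map_neg, wAct_wAct_inv_mul, mul_assoc]
  · simp only [ldd, rdd, map_div₀, map_sub, map_neg, wAct_sref_sref_mul, mul_assoc]
    ring
end
end

section
/- (Conjugation by the longest element relates the two variants of the K-theoretic left Demazure operators.) Let w_0 ∈ S_n be the longest element, w_0(i) = n+1−i. Then for every integer i with 1 ≤ i ≤ n−1, w_0^L ∘ δ_i ∘ w_0^L = δ_{n−i}^∨ as operators on M. -/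
open MvPolynomial Finset

noncomputable section

/-- The field `K = ℚ(y, z_1, …, z_n)`, realized as the fraction field of the polynomial ring
in variables indexed by `Option (Fin n)`: `none ↦ y` and `some i ↦ z_i`. -/
abbrev KK (n : ℕ) : Type := FractionRing (MvPolynomial (Option (Fin n)) ℚ)

/-- The action of `S_n` on `K` by `ℚ`-algebra automorphisms permuting the `z`-variables
(`w · z_i = z_{w(i)}`) and fixing `y`. -/
noncomputable def wActK {n : ℕ} (w : Equiv.Perm (Fin n)) : KK n ≃+* KK n :=
  IsFractionRing.ringEquivOfRingEquiv
    (MvPolynomial.renameEquiv ℚ (Equiv.optionCongr w)).toRingEquiv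

/-- The variable `z` (with a `Fin n` index) as an element of `K`. -/
noncomputable def zv {n : ℕ} (i : Fin n) : KK n :=
  algebraMap (MvPolynomial (Option (Fin n)) ℚ) (KK n) (MvPolynomial.X (some i))

/-- The variable `y` as an element of `K`. -/
noncomputable def yv {n : ℕ} : KK n :=
  algebraMap (MvPolynomial (Option (Fin n)) ℚ) (KK n) (MvPolynomial.X none)

/-- The localization model `M`: functions `S_n → K`, with pointwise operations. -/
abbrev MK (n : ℕ) : Type := Equiv.Perm (Fin n) → KK n

/-- The left Weyl action `(w^L f)(u) = w · (f (w⁻¹ u))`. -/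
noncomputable def leftWK {n : ℕ} (w : Equiv.Perm (Fin n)) (f : MK n) : MK n :=
  fun u => wActK w (f (w⁻¹ * u))

/-- The right Weyl action `(w^R f)(u) = f (u w)`. -/
noncomputable def rightWK {n : ℕ} (w : Equiv.Perm (Fin n)) (f : MK n) : MK n :=
  fun u => f (u * w)

/-- The simple transposition `s_i = (i, i+1)` (1-based index `i`, `1 ≤ i ≤ n-1`). -/
def srefK {n : ℕ} (i : ℕ) (h1 : 1 ≤ i) (h2 : i ≤ n - 1) : Equiv.Perm (Fin n) :=
  Equiv.swap ⟨i - 1, by omega⟩ ⟨i, by omega⟩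

/-- `e^{α_i} = z_i / z_{i+1}` (1-based index). -/
noncomputable def ealf {n : ℕ} (i : ℕ) (h1 : 1 ≤ i) (h2 : i ≤ n - 1) : KK n :=
  zv ⟨i - 1, by omega⟩ / zv ⟨i, by omega⟩

/-- `e^{-α_i} = z_{i+1} / z_i` (1-based index). -/
noncomputable def ealfInv {n : ℕ} (i : ℕ) (h1 : 1 ≤ i) (h2 : i ≤ n - 1) : KK n :=
  zv ⟨i, by omega⟩ / zv ⟨i - 1, by omega⟩

/-- The K-theoretic left Demazure operator
`(δ_i f)(v) = (f(v) - e^{α_i}·s_i·(f(s_i v))) / (1 - e^{α_i})`. -/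
noncomputable def lddK {n : ℕ} (i : ℕ) (h1 : 1 ≤ i) (h2 : i ≤ n - 1) (f : MK n) : MK n :=
  fun v => (f v - ealf i h1 h2 * wActK (srefK i h1 h2) (f (srefK i h1 h2 * v)))
    / (1 - ealf i h1 h2)

/-- The dual K-theoretic left Demazure operator
`(δ_i^∨ f)(v) = (f(v) - e^{-α_i}·s_i·(f(s_i v))) / (1 - e^{-α_i})`. -/
noncomputable def lddKd {n : ℕ} (i : ℕ) (h1 : 1 ≤ i) (h2 : i ≤ n - 1) (f : MK n) : MK n :=
  fun v => (f v - ealfInv i h1 h2 * wActK (srefK i h1 h2) (f (srefK i h1 h2 * v)))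
    / (1 - ealfInv i h1 h2)

/-- The K-theoretic right Demazure operator
`(∂_i f)(v) = (f(v) - e^{v·α_i}·f(v s_i)) / (1 - e^{v·α_i})`. -/
noncomputable def rddK {n : ℕ} (i : ℕ) (h1 : 1 ≤ i) (h2 : i ≤ n - 1) (f : MK n) : MK n :=
  fun v => (f v - wActK v (ealf i h1 h2) * f (v * srefK i h1 h2))
    / (1 - wActK v (ealf i h1 h2))

/-- The K-theoretic fixed-point class `ι_w ∈ M`:
`ι_w(u) = ∏_{a<b} (1 - z_{w(a)}/z_{w(b)})` if `u = w`, and `0` otherwise. -/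
noncomputable def iot {n : ℕ} (w : Equiv.Perm (Fin n)) : MK n := fun u =>
  if u = w then
    ∏ p ∈ Finset.univ.filter (fun p : Fin n × Fin n => p.1 < p.2), (1 - zv (w p.1) / zv (w p.2))
  else 0

/-- The K-theoretic left Demazure–Lusztig operator
`(T_i^L f)(v) = ((1 + y e^{-α_i}) · s_i·(f(s_i v)) - (1 + y) f(v)) / (1 - e^{-α_i})`. -/
noncomputable def tKL {n : ℕ} (i : ℕ) (h1 : 1 ≤ i) (h2 : i ≤ n - 1) (f : MK n) : MK n :=
  fun v => ((1 + yv * ealfInv i h1 h2) * wActK (srefK i h1 h2) (f (srefK i h1 h2 * v))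
    - (1 + yv) * f v) / (1 - ealfInv i h1 h2)

/-- The dual K-theoretic left Demazure–Lusztig operator
`(T_i^{L,∨} f)(v) = ((1 + y e^{α_i}) · s_i·(f(s_i v)) - (1 + y) f(v)) / (1 - e^{α_i})`. -/
noncomputable def tKLd {n : ℕ} (i : ℕ) (h1 : 1 ≤ i) (h2 : i ≤ n - 1) (f : MK n) : MK n :=
  fun v => ((1 + yv * ealf i h1 h2) * wActK (srefK i h1 h2) (f (srefK i h1 h2 * v))
    - (1 + yv) * f v) / (1 - ealf i h1 h2)

/-- Pointwise multiplication of an element of `M` by a constant `c ∈ K`. -/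
noncomputable def emul {n : ℕ} (c : KK n) (f : MK n) : MK n := fun v => c * f v

theorem wActK_algebraMap {n : ℕ} (w : Equiv.Perm (Fin n))
    (p : MvPolynomial (Option (Fin n)) ℚ) :
    wActK w (algebraMap _ (KK n) p) =
      algebraMap _ (KK n) (MvPolynomial.rename (Equiv.optionCongr w) p) := by
  simp [wActK]

theorem wActK_zv {n : ℕ} (w : Equiv.Perm (Fin n)) (j : Fin n) :
    wActK w (zv j) = zv (w j) := by
  simp [zv, wActK_algebraMap]

theorem wActK_mul_apply {n : ℕ} (u v : Equiv.Perm (Fin n)) (x : KK n) :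
    wActK (u * v) x = wActK u (wActK v x) := by
  obtain ⟨p, q, -, rfl⟩ :=
    IsFractionRing.div_surjective (A := MvPolynomial (Option (Fin n)) ℚ) x
  simp only [map_div₀, wActK_algebraMap, MvPolynomial.rename_rename]
  have h : (Equiv.optionCongr (u * v) : Option (Fin n) → Option (Fin n)) =
      Equiv.optionCongr u ∘ Equiv.optionCongr v := by
    ext1 a; cases a <;> simp
  rw [h]

theorem wActK_one_apply {n : ℕ} (x : KK n) : wActK 1 x = x := by
  apply (wActK (1 : Equiv.Perm (Fin n))).injective
  rw [← wActK_mul_apply, one_mul]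

theorem revPerm_mul_self {n : ℕ} :
    (Fin.revPerm : Equiv.Perm (Fin n)) * Fin.revPerm = 1 := by
  ext1 a; simp

theorem revPerm_conj_srefK {n : ℕ} (i : ℕ) (h1 : 1 ≤ i) (h2 : i ≤ n - 1) :
    Fin.revPerm * srefK i h1 h2 * Fin.revPerm =
      srefK (n := n) (n - i) (by omega) (by omega) := by
  have h : (Fin.revPerm : Equiv.Perm (Fin n)) * srefK i h1 h2 * Fin.revPerm⁻¹ =
      srefK (n := n) (n - i) (by omega) (by omega) := by
    unfold srefK
    rw [← Equiv.swap_apply_apply, Equiv.swap_comm]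
    congr 1 <;> ext <;> simp [Fin.val_rev] <;> omega
  rwa [inv_eq_of_mul_eq_one_left revPerm_mul_self] at h

theorem wActK_revPerm_ealf {n : ℕ} (i : ℕ) (h1 : 1 ≤ i) (h2 : i ≤ n - 1) :
    wActK Fin.revPerm (ealf i h1 h2) = ealfInv (n := n) (n - i) (by omega) (by omega) := by
  unfold ealf ealfInv
  rw [map_div₀, wActK_zv, wActK_zv]
  congr 2 <;> ext <;> simp [Fin.val_rev] <;> omega

/-- Conjugation by the longest element `w_0` (given by `w_0(i) = n+1-i`) relates the two
variants of the K-theoretic left Demazure operators: `w_0^L ∘ δ_i ∘ w_0^L = δ_{n-i}^∨`. -/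
theorem K_left_demazure_conjugation_by_longest_element
    (n : ℕ) (hn : 2 ≤ n) (i : ℕ) (h1 : 1 ≤ i) (h2 : i ≤ n - 1) (f : MK n) :
    leftWK Fin.revPerm (lddK i h1 h2 (leftWK Fin.revPerm f))
      = lddKd (n - i) (by omega) (by omega) f := by
  have hinv : (Fin.revPerm : Equiv.Perm (Fin n))⁻¹ = Fin.revPerm :=
    inv_eq_of_mul_eq_one_left revPerm_mul_self
  ext1 v
  simp only [leftWK, lddK, lddKd, hinv, map_div₀, map_sub, map_mul, map_one,
    wActK_revPerm_ealf, ← wActK_mul_apply, ← mul_assoc, revPerm_mul_self, wActK_one_apply,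
    revPerm_conj_srefK, one_mul]
end
end

section
/- (Commutation relations between the K-theoretic left and right Demazure operators and the Weyl actions.) For all integers i, j with 1 ≤ i, j ≤ n−1, the following hold as operators on M: δ_i ∘ s_j^R = s_j^R ∘ δ_i, ∂_i ∘ s_j^L = s_j^L ∘ ∂_i, and δ_i ∘ ∂_j = ∂_j ∘ δ_i. -/
open MvPolynomial Finset

noncomputable section

/-- The action of `S_n` on `K` is multiplicative in the group element. -/
theorem wActK_mul {n : ℕ} (w u : Equiv.Perm (Fin n)) (x : KK n) :
    wActK (w * u) x = wActK w (wActK u x) := by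
  have hpoly (v : Equiv.Perm (Fin n)) (p : MvPolynomial (Option (Fin n)) ℚ) :
      wActK v (algebraMap _ (KK n) p) = algebraMap _ (KK n) (rename (Option.map v) p) := by
    simp only [wActK, IsFractionRing.ringEquivOfRingEquiv_algebraMap]
    rfl
  obtain ⟨p, q, -, rfl⟩ := IsFractionRing.div_surjective (A := MvPolynomial (Option (Fin n)) ℚ) x
  simp only [map_div₀, hpoly, rename_rename, Equiv.Perm.coe_mul, Option.map_comp_map]

theorem srefK_mul_self {n : ℕ} (i : ℕ) (h1 : 1 ≤ i) (h2 : i ≤ n - 1) :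
    srefK (n := n) i h1 h2 * srefK i h1 h2 = 1 :=
  Equiv.swap_mul_self _ _

/-- Acting by `u` after translating by `u⁻¹` recovers the original action. -/
theorem wActK_wActK_inv_mul {n : ℕ} (u v : Equiv.Perm (Fin n)) (x : KK n) :
    wActK u (wActK (u⁻¹ * v) x) = wActK v x := by
  rw [← wActK_mul, mul_inv_cancel_left]

theorem wActK_srefK_wActK_srefK_mul {n : ℕ} (i : ℕ) (h1 : 1 ≤ i) (h2 : i ≤ n - 1)
    (v : Equiv.Perm (Fin n)) (x : KK n) :
    wActK (srefK i h1 h2) (wActK (srefK i h1 h2 * v) x) = wActK v x := by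
  rw [← wActK_mul, ← mul_assoc, srefK_mul_self, one_mul]

theorem lddK_rightWK {n : ℕ} (i : ℕ) (h1 : 1 ≤ i) (h2 : i ≤ n - 1)
    (w : Equiv.Perm (Fin n)) (f : MK n) :
    lddK i h1 h2 (rightWK w f) = rightWK w (lddK i h1 h2 f) := by
  funext v
  simp only [lddK, rightWK, mul_assoc]

theorem rddK_leftWK {n : ℕ} (i : ℕ) (h1 : 1 ≤ i) (h2 : i ≤ n - 1)
    (w : Equiv.Perm (Fin n)) (f : MK n) :
    rddK i h1 h2 (leftWK w f) = leftWK w (rddK i h1 h2 f) := by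
  funext v
  simp only [rddK, leftWK, map_div₀, map_sub, map_mul, map_one, wActK_wActK_inv_mul, mul_assoc]

theorem lddK_rddK {n : ℕ} (i j : ℕ) (hi1 : 1 ≤ i) (hi2 : i ≤ n - 1)
    (hj1 : 1 ≤ j) (hj2 : j ≤ n - 1) (f : MK n) :
    lddK i hi1 hi2 (rddK j hj1 hj2 f) = rddK j hj1 hj2 (lddK i hi1 hi2 f) := by
  funext v
  simp only [lddK, rddK, map_div₀, map_sub, map_mul, map_one, wActK_srefK_wActK_srefK_mul,
    ← mul_assoc (srefK i hi1 hi2)]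
  generalize wActK v (ealf j hj1 hj2) = c
  generalize (ealf i hi1 hi2 : KK n) = a
  ring

/-- Commutation relations between the K-theoretic left and right Demazure operators and
the Weyl actions: `δ_i ∘ s_j^R = s_j^R ∘ δ_i`, `∂_i ∘ s_j^L = s_j^L ∘ ∂_i`,
and `δ_i ∘ ∂_j = ∂_j ∘ δ_i`. -/
theorem K_demazure_commutation
    (n : ℕ) (hn : 2 ≤ n) (i j : ℕ) (hi1 : 1 ≤ i) (hi2 : i ≤ n - 1)
    (hj1 : 1 ≤ j) (hj2 : j ≤ n - 1) :
    (∀ f : MK n, lddK i hi1 hi2 (rightWK (srefK j hj1 hj2) f)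
        = rightWK (srefK j hj1 hj2) (lddK i hi1 hi2 f)) ∧
    (∀ f : MK n, rddK i hi1 hi2 (leftWK (srefK j hj1 hj2) f)
        = leftWK (srefK j hj1 hj2) (rddK i hi1 hi2 f)) ∧
    (∀ f : MK n, lddK i hi1 hi2 (rddK j hj1 hj2 f)
        = rddK j hj1 hj2 (lddK i hi1 hi2 f)) := by
  exact ⟨lddK_rightWK i hi1 hi2 _, rddK_leftWK i hi1 hi2 _, lddK_rddK i j hi1 hi2 hj1 hj2⟩
end
end

section
/- (Hecke quadratic relation for the K-theoretic left Demazure–Lusztig operators.) For every integer i with 1 ≤ i ≤ n−1, (T_i^L + id) ∘ (T_i^L + y·id) = 0 and (T_i^{L,∨} + id) ∘ (T_i^{L,∨} + y·id) = 0 as operators on M, where y·id denotes pointwise multiplication by the constant y ∈ K. -/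
open MvPolynomial Finset

noncomputable section

/-- The quadratic relation for `T = (1 - a)⁻¹ ((1 + y a) σ - (1 + y))`, where `σ` is an involutive
semilinear operator inverting `a` and fixing `y`. Here `F` and `G` play the roles of the values
`f v` and `f (s v)`. -/
theorem hecke_quadratic_of_involution {K : Type*} [Field K] (σ : K ≃+* K) {a y : K}
    (ha : a ≠ 0) (ha1 : a ≠ 1) (hσa : σ a = a⁻¹) (hσy : σ y = y) (hσ : ∀ x, σ (σ x) = x)
    (F G : K) :
    ((1 + y * a) * σ (((1 + y * a) * σ F - (1 + y) * G) / (1 - a) + y * G)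
      - (1 + y) * (((1 + y * a) * σ G - (1 + y) * F) / (1 - a) + y * F)) / (1 - a)
      + (((1 + y * a) * σ G - (1 + y) * F) / (1 - a) + y * F) = 0 := by
  have h1 : 1 - a ≠ 0 := sub_ne_zero.mpr ha1.symm
  have h2 : a - 1 ≠ 0 := sub_ne_zero.mpr ha1
  have h3 : 1 - a⁻¹ = (a - 1) / a := by field_simp
  simp only [map_add, map_sub, map_mul, map_div₀, map_one, hσa, hσy, hσ, h3]
  generalize σ G = X
  have h4 : a - 1 = -(1 - a) := by ring
  rw [h4]
  field_simp
  ring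

theorem wActK_algebraMap_X {n : ℕ} (w : Equiv.Perm (Fin n)) (j : Option (Fin n)) :
    wActK w (algebraMap (MvPolynomial (Option (Fin n)) ℚ) (KK n) (X j)) =
      algebraMap (MvPolynomial (Option (Fin n)) ℚ) (KK n) (X (j.map w)) := by
  simp [wActK]

theorem wActK_yv {n : ℕ} (w : Equiv.Perm (Fin n)) : wActK w yv = yv :=
  wActK_algebraMap_X w none

theorem wActK_wActK_of_mul_self {n : ℕ} {w : Equiv.Perm (Fin n)} (hw : w * w = 1) (x : KK n) :
    wActK w (wActK w x) = x := by
  have hinv (j : Option (Fin n)) : (j.map w).map w = j := by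
    cases j with
    | none => rfl
    | some j => exact congrArg some (congrArg (fun u : Equiv.Perm (Fin n) => u j) hw)
  have hpoly (p : MvPolynomial (Option (Fin n)) ℚ) :
      wActK w (wActK w (algebraMap _ (KK n) p)) = algebraMap _ (KK n) p := by
    induction p using MvPolynomial.induction_on with
    | C q => simp [wActK]
    | add p q hp hq => simp only [map_add, hp, hq]
    | mul_X p j hp => simp only [map_mul, hp, wActK_algebraMap_X, hinv]
  obtain ⟨p, q, -, rfl⟩ := IsFractionRing.div_surjective (A := MvPolynomial (Option (Fin n)) ℚ) x
  simp only [map_div₀, hpoly]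

theorem zv_injective {n : ℕ} : Function.Injective (zv : Fin n → KK n) :=
  (IsFractionRing.injective (MvPolynomial (Option (Fin n)) ℚ) (KK n)).comp
    ((MvPolynomial.X_injective).comp (Option.some_injective _))

theorem zv_ne_zero {n : ℕ} (j : Fin n) : (zv j : KK n) ≠ 0 := by
  simp [zv, MvPolynomial.X_ne_zero]

/-- The quadratic relation for the operator attached to the ratio `z_k / z_j` and the
transposition of `j` and `k`. -/
theorem hecke_quadratic_swap {n : ℕ} {j k : Fin n} (hjk : j ≠ k) {s : Equiv.Perm (Fin n)}
    (hs : s = Equiv.swap j k) {T : MK n → MK n}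
    (hT : ∀ f v, T f v = ((1 + yv * (zv k / zv j)) * wActK s (f (s * v)) - (1 + yv) * f v)
      / (1 - zv k / zv j)) (f : MK n) :
    T (T f + emul yv f) + (T f + emul yv f) = 0 := by
  have hss : s * s = 1 := by rw [hs, Equiv.swap_mul_self]
  funext v
  have hv : s * (s * v) = v := by rw [← mul_assoc, hss, one_mul]
  simp only [Pi.add_apply, Pi.zero_apply, hT, emul, hv]
  refine hecke_quadratic_of_involution (wActK s) (div_ne_zero (zv_ne_zero k) (zv_ne_zero j)) ?_ ?_
    (wActK_yv s) (wActK_wActK_of_mul_self hss) (f v) (f (s * v))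
  · rw [Ne, div_eq_one_iff_eq (zv_ne_zero j)]
    exact fun h => hjk (zv_injective h).symm
  · rw [map_div₀, wActK_zv, wActK_zv, inv_div, hs, Equiv.swap_apply_left, Equiv.swap_apply_right]

/-- Hecke quadratic relation for the K-theoretic left Demazure–Lusztig operators:
`(T_i^L + id) ∘ (T_i^L + y·id) = 0` and `(T_i^{L,∨} + id) ∘ (T_i^{L,∨} + y·id) = 0`. -/
theorem K_left_DL_hecke_quadratic
    (n : ℕ) (hn : 2 ≤ n) (i : ℕ) (h1 : 1 ≤ i) (h2 : i ≤ n - 1) :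
    (∀ f : MK n,
      tKL i h1 h2 (tKL i h1 h2 f + emul yv f) + (tKL i h1 h2 f + emul yv f) = 0) ∧
    (∀ f : MK n,
      tKLd i h1 h2 (tKLd i h1 h2 f + emul yv f) + (tKLd i h1 h2 f + emul yv f) = 0) := by
  have hne : (⟨i - 1, by omega⟩ : Fin n) ≠ ⟨i, by omega⟩ := by
    rw [Ne, Fin.mk.injEq]
    omega
  exact ⟨hecke_quadratic_swap hne rfl fun _ _ => rfl,
    hecke_quadratic_swap hne.symm (Equiv.swap_comm _ _) fun _ _ => rfl⟩
end
end
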